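/- arXiv:1507.06989 — 4 statements merged into one kernel-verified Lean document; each statement's English description precedes it below -/
import Mathlib

section
/- Let x, y, z be positive reals with z > x and z > y, and let t < u be real numbers. If z^t ≥ x^t + y^t, then z^u > x^u + y^u. -/
theorem Real.rpow_lt_rpow_mul_rpow_sub {a b t u : ℝ} (ha : 0 < a) (hab : a < b) (htu : t < u) :
    a ^ u < a ^ t * b ^ (u - t) :=
  calc a ^ u = a ^ t * a ^ (u - t) := by rw [← Real.rpow_add ha, add_sub_cancel]
    _ < a ^ t * b ^ (u - t) :=
      mul_lt_mul_of_pos_left (Real.rpow_lt_rpow ha.le hab (sub_pos.2 htu))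
        (Real.rpow_pos_of_pos ha t)

/-- Persistence of the reversed inequality for real exponents: if `0 < x < z`,
`0 < y < z` and `z ^ t ≥ x ^ t + y ^ t` at some real exponent `t`, then
`z ^ u > x ^ u + y ^ u` for every real `u > t`. -/
theorem reversion_persists (x y z : ℝ) (hx : 0 < x) (hy : 0 < y) (hz : 0 < z)
    (hxz : x < z) (hyz : y < z) (t u : ℝ) (htu : t < u)
    (h : x ^ t + y ^ t ≤ z ^ t) : x ^ u + y ^ u < z ^ u :=
  calc x ^ u + y ^ u < x ^ t * z ^ (u - t) + y ^ t * z ^ (u - t) :=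
      add_lt_add (Real.rpow_lt_rpow_mul_rpow_sub hx hxz htu)
        (Real.rpow_lt_rpow_mul_rpow_sub hy hyz htu)
    _ = (x ^ t + y ^ t) * z ^ (u - t) := (add_mul _ _ _).symm
    _ ≤ z ^ t * z ^ (u - t) := mul_le_mul_of_nonneg_right h (Real.rpow_nonneg hz.le _)
    _ = z ^ u := by rw [← Real.rpow_add hz, add_sub_cancel]
end

section
/- Let x, y, z be positive integers with z > x > y, z < x + y and z^2 < x^2 + y^2, and let n be an integer such that z^(n−1) < x^(n−1) + y^(n−1) and z^n > x^n + y^n. Set k_{n−1} = (x^n + y^n)/(x^(n−1) + y^(n−1)). Then 1/2 < log(k_{n−1})/log z < 1. -/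
/-- The quotient `(x ^ (m + 1) + y ^ (m + 1)) / (x ^ m + y ^ m)` is a weighted mean of `x` and `y`,
so it lies strictly between them. -/
theorem pow_succ_add_div_pow_add_mem_Ioo {x y : ℝ} (hy : 0 < y) (hyx : y < x) (m : ℕ) :
    (x ^ (m + 1) + y ^ (m + 1)) / (x ^ m + y ^ m) ∈ Set.Ioo y x := by
  have hx : 0 < x := hy.trans hyx
  have hxm : 0 < x ^ m := pow_pos hx m
  have hym : 0 < y ^ m := pow_pos hy m
  constructor
  · rw [lt_div_iff₀ (by positivity)]
    nlinarith [mul_pos hxm (sub_pos.mpr hyx), pow_succ x m, pow_succ y m]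
  · rw [div_lt_iff₀ (by positivity)]
    nlinarith [mul_pos hym (sub_pos.mpr hyx), pow_succ x m, pow_succ y m]


/-- Bounding `b - a = log(k_{n-1})/log z` for an acute scalene integer triangle:
`1/2 < log(k_{n-1})/log z < 1`. -/
theorem b_sub_a_bounds (x y z n : ℕ) (hy : 0 < y) (hyx : y < x) (hxz : x < z)
    (htri : z < x + y) (hacute : z ^ 2 < x ^ 2 + y ^ 2)
    (h1 : z ^ (n - 1) < x ^ (n - 1) + y ^ (n - 1)) (h2 : x ^ n + y ^ n < z ^ n) :
    1 / 2 < Real.log (((x : ℝ) ^ n + (y : ℝ) ^ n) /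
        ((x : ℝ) ^ (n - 1) + (y : ℝ) ^ (n - 1))) / Real.log z ∧
      Real.log (((x : ℝ) ^ n + (y : ℝ) ^ n) /
        ((x : ℝ) ^ (n - 1) + (y : ℝ) ^ (n - 1))) / Real.log z < 1 := by
  obtain _ | m := n
  · simp at h2
  rw [Nat.add_sub_cancel]
  have hyR : (0 : ℝ) < y := by exact_mod_cast hy
  have hxzR : (x : ℝ) < z := by exact_mod_cast hxz
  obtain ⟨hyk, hkx⟩ := pow_succ_add_div_pow_add_mem_Ioo hyR (Nat.cast_lt.mpr hyx) m
  set k : ℝ := ((x : ℝ) ^ (m + 1) + (y : ℝ) ^ (m + 1)) / ((x : ℝ) ^ m + (y : ℝ) ^ m)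
  have hk : 0 < k := hyR.trans hyk
  have hz : (0 : ℝ) < z := hk.trans (hkx.trans hxzR)
  have hlogz : 0 < Real.log z := Real.log_pos (by exact_mod_cast (show 1 < z by omega))
  constructor
  · have hzy : z < y ^ 2 := by nlinarith
    have hzk : (z : ℝ) < k ^ 2 :=
      calc (z : ℝ) < (y : ℝ) ^ 2 := by exact_mod_cast hzy
        _ < k ^ 2 := by gcongr
    have hlog := Real.log_lt_log hz hzk
    rw [Real.log_pow] at hlog
    rw [lt_div_iff₀ hlogz]
    push_cast at hlog
    linarith
  · rw [div_lt_one hlogz]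
    exact Real.log_lt_log hk (hkx.trans hxzR)
end

section
/- Let x, y, z be positive integers with z > x > y, z < x + y and z^2 < x^2 + y^2, and let n be an integer such that z^(n−1) < x^(n−1) + y^(n−1) and z^n > x^n + y^n. Then 0 < n − log(x^n + y^n)/log z < 1/2. -/
/-- A power-mean type inequality bounding consecutive power sums of two numbers. -/
lemma sq_powerSum_mul_le {x y : ℝ} (hy : 0 < y) (hyx : y ≤ x) (k : ℕ) :
    (x ^ (k + 1) + y ^ (k + 1)) ^ 2 * (x ^ 2 + y ^ 2) ≤
      2 * (x ^ (k + 2) + y ^ (k + 2)) ^ 2 := by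
  have hx : 0 < x := hy.trans_le hyx
  have hk : y ^ k ≤ x ^ k := pow_le_pow_left₀ hy.le hyx k
  have key : (x ^ (k + 1) + y ^ (k + 1)) * (x ^ 2 + y ^ 2) ≤
      (x ^ (k + 2) + y ^ (k + 2)) * (x + y) := by
    have h : 0 ≤ x * y * ((x - y) * (x ^ k - y ^ k)) :=
      mul_nonneg (by positivity) (mul_nonneg (sub_nonneg.2 hyx) (sub_nonneg.2 hk))
    linear_combination h
  have hsq : (x + y) ^ 2 ≤ 2 * (x ^ 2 + y ^ 2) := add_sq_le
  have hpos : 0 < x ^ 2 + y ^ 2 := by positivity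
  refine le_of_mul_le_mul_right ?_ hpos
  calc (x ^ (k + 1) + y ^ (k + 1)) ^ 2 * (x ^ 2 + y ^ 2) * (x ^ 2 + y ^ 2)
      = ((x ^ (k + 1) + y ^ (k + 1)) * (x ^ 2 + y ^ 2)) ^ 2 := by ring
    _ ≤ ((x ^ (k + 2) + y ^ (k + 2)) * (x + y)) ^ 2 :=
        pow_le_pow_left₀ (by positivity) key 2
    _ = (x ^ (k + 2) + y ^ (k + 2)) ^ 2 * (x + y) ^ 2 := by ring
    _ ≤ (x ^ (k + 2) + y ^ (k + 2)) ^ 2 * (2 * (x ^ 2 + y ^ 2)) := by gcongr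
    _ = 2 * (x ^ (k + 2) + y ^ (k + 2)) ^ 2 * (x ^ 2 + y ^ 2) := by ring

/-- Improved Corollary 1: for an acute scalene integer triangle with reversion
exponent `n`, one has `0 < n - log(x^n + y^n)/log z < 1/2`. -/
theorem corollary1_improved (x y z n : ℕ) (hy : 0 < y) (hyx : y < x) (hxz : x < z)
    (htri : z < x + y) (hacute : z ^ 2 < x ^ 2 + y ^ 2)
    (h1 : z ^ (n - 1) < x ^ (n - 1) + y ^ (n - 1)) (h2 : x ^ n + y ^ n < z ^ n) :
    0 < (n : ℝ) - Real.log ((x : ℝ) ^ n + (y : ℝ) ^ n) / Real.log z ∧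
      (n : ℝ) - Real.log ((x : ℝ) ^ n + (y : ℝ) ^ n) / Real.log z < 1 / 2 := by
  obtain ⟨k, rfl⟩ : ∃ k, n = k + 2 := by
    match n, h2 with
    | 0, h2 => simp at h2
    | 1, h2 => simp only [pow_one] at h2; omega
    | k + 2, _ => exact ⟨k, rfl⟩
  have hz : (2 : ℝ) ≤ z := by exact_mod_cast (by omega : 2 ≤ z)
  have hy' : (0 : ℝ) < y := by exact_mod_cast hy
  have hyx' : (y : ℝ) ≤ x := by exact_mod_cast hyx.le
  have hx' : (0 : ℝ) < x := hy'.trans_le hyx'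
  have hacute' : (z : ℝ) ^ 2 < (x : ℝ) ^ 2 + (y : ℝ) ^ 2 := by exact_mod_cast hacute
  have h1' : (z : ℝ) ^ (k + 1) < (x : ℝ) ^ (k + 1) + (y : ℝ) ^ (k + 1) := by
    exact_mod_cast h1
  have h2' : (x : ℝ) ^ (k + 2) + (y : ℝ) ^ (k + 2) < (z : ℝ) ^ (k + 2) := by
    exact_mod_cast h2
  have hlog : 0 < Real.log z := Real.log_pos (by linarith)
  have hP : 0 < (x : ℝ) ^ (k + 2) + (y : ℝ) ^ (k + 2) := by positivity
  constructor
  · rw [sub_pos, div_lt_iff₀ hlog, ← Real.log_pow]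
    exact Real.log_lt_log hP h2'
  · have hlt : (z : ℝ) ^ (2 * k + 3) < ((x : ℝ) ^ (k + 2) + (y : ℝ) ^ (k + 2)) ^ 2 := by
      have hprod : ((z : ℝ) ^ (k + 1)) ^ 2 * (z : ℝ) ^ 2 <
          ((x : ℝ) ^ (k + 1) + (y : ℝ) ^ (k + 1)) ^ 2 * ((x : ℝ) ^ 2 + (y : ℝ) ^ 2) := by
        gcongr
      have hdouble : 2 * (z : ℝ) ^ (2 * k + 3) ≤ ((z : ℝ) ^ (k + 1)) ^ 2 * (z : ℝ) ^ 2 := by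
        calc 2 * (z : ℝ) ^ (2 * k + 3) ≤ z * (z : ℝ) ^ (2 * k + 3) := by gcongr
          _ = ((z : ℝ) ^ (k + 1)) ^ 2 * (z : ℝ) ^ 2 := by ring
      linarith [sq_powerSum_mul_le hy' hyx' k]
    have hlogs := Real.log_lt_log (by positivity) hlt
    rw [Real.log_pow, Real.log_pow] at hlogs
    rw [sub_lt_comm, lt_div_iff₀ hlog]
    push_cast at hlogs ⊢
    linarith
end

section
/- Let x, y, z be reals with z > x > y > 0. Then there exists a unique real number s with z^s = x^s + y^s; this s is positive. Moreover, if n ≥ 1 is an integer with z^(n−1) < x^(n−1) + y^(n−1) and z^n > x^n + y^n, then n − 1 < s < n. -/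
theorem strictAnti_rpow_add_rpow {a b : ℝ} (ha : 0 < a) (ha1 : a < 1) (hb : 0 < b) (hb1 : b < 1) :
    StrictAnti fun t : ℝ => a ^ t + b ^ t := fun _ _ h =>
  add_lt_add (Real.rpow_lt_rpow_of_exponent_gt ha ha1 h) (Real.rpow_lt_rpow_of_exponent_gt hb hb1 h)

theorem exists_rpow_add_rpow_eq_one {a b : ℝ} (ha : 0 < a) (ha1 : a < 1) (hb : 0 < b)
    (hb1 : b < 1) : ∃ t : ℝ, a ^ t + b ^ t = 1 := by
  have hcont : Continuous fun t : ℝ => a ^ t + b ^ t :=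
    (Real.continuous_const_rpow ha.ne').add (Real.continuous_const_rpow hb.ne')
  have hlim : Filter.Tendsto (fun t : ℝ => a ^ t + b ^ t) Filter.atTop (nhds 0) := by
    simpa using (tendsto_rpow_atTop_of_base_lt_one a (by linarith) ha1).add
      (tendsto_rpow_atTop_of_base_lt_one b (by linarith) hb1)
  obtain ⟨u, hu⟩ := (hlim.eventually_lt_const one_pos).exists
  exact mem_range_of_exists_le_of_exists_ge hcont ⟨u, hu.le⟩ ⟨0, by norm_num⟩


/-- The equalizing exponent: for reals `z > x > y > 0` there is a unique real `s`
with `z ^ s = x ^ s + y ^ s`; it is positive, and if `n ≥ 1` is an integer with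
`z ^ (n-1) < x ^ (n-1) + y ^ (n-1)` and `z ^ n > x ^ n + y ^ n`, then
`n - 1 < s < n`. (Real-exponent powers.) -/
theorem equalizing_exponent (x y z : ℝ) (hy : 0 < y) (hyx : y < x) (hxz : x < z) :
    (∃! s : ℝ, z ^ s = x ^ s + y ^ s) ∧
    ∀ s : ℝ, z ^ s = x ^ s + y ^ s →
      0 < s ∧
      ∀ n : ℕ, 1 ≤ n →
        z ^ ((n : ℝ) - 1) < x ^ ((n : ℝ) - 1) + y ^ ((n : ℝ) - 1) →
        x ^ (n : ℝ) + y ^ (n : ℝ) < z ^ (n : ℝ) →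
        (n : ℝ) - 1 < s ∧ s < n := by
  have hx : 0 < x := hy.trans hyx
  have hz : 0 < z := hx.trans hxz
  have ha : 0 < x / z := div_pos hx hz
  have hb : 0 < y / z := div_pos hy hz
  have ha1 : x / z < 1 := (div_lt_one hz).2 hxz
  have hb1 : y / z < 1 := (div_lt_one hz).2 (hyx.trans hxz)
  have hanti := strictAnti_rpow_add_rpow ha ha1 hb hb1
  have hdiv (t : ℝ) : (x / z) ^ t + (y / z) ^ t = (x ^ t + y ^ t) / z ^ t := by
    rw [Real.div_rpow hx.le hz.le, Real.div_rpow hy.le hz.le, add_div]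
  have hpos (t : ℝ) : 0 < z ^ t := Real.rpow_pos_of_pos hz t
  have hiff (t : ℝ) : z ^ t = x ^ t + y ^ t ↔ (x / z) ^ t + (y / z) ^ t = 1 := by
    rw [hdiv, div_eq_one_iff_eq (hpos t).ne', eq_comm]
  refine ⟨?_, fun s hs => ?_⟩
  · obtain ⟨s, hs⟩ := exists_rpow_add_rpow_eq_one ha ha1 hb hb1
    exact ⟨s, (hiff s).2 hs, fun t ht => hanti.injective (((hiff t).1 ht).trans hs.symm)⟩
  · rw [hiff] at hs
    refine ⟨hanti.lt_iff_gt.1 ?_, fun n _ hlow hhigh =>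
      ⟨hanti.lt_iff_gt.1 ?_, hanti.lt_iff_gt.1 ?_⟩⟩
    · simp only [hs, Real.rpow_zero]
      norm_num
    · simp only [hs, hdiv]
      exact (one_lt_div (hpos _)).2 hlow
    · simp only [hs, hdiv]
      exact (div_lt_one (hpos _)).2 hhigh
end
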